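/- Let t' be the unique real number with ∑_{n=1}^∞ (n + 1/n)^{t'} = 1 (so −1.83 < t' < −1.82). Then for every real t > t', P(t) > 0, where P(t) := lim_{n→∞} (1/n) log ∑_{I ∈ {1,2}^n} ‖A_{i_{n−1}} ⋯ A_{i_0}‖^t. -/

import Mathlib

open Filter

/-- The parabolic matrix `A₁ = [[1,0],[1,1]]`. -/
def A1 : Matrix (Fin 2) (Fin 2) ℝ := !![1, 0; 1, 1]

/-- The parabolic matrix `A₂ = [[1,1],[0,1]]`. -/
def A2 : Matrix (Fin 2) (Fin 2) ℝ := !![1, 1; 0, 1]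

/-- The operator norm on 2×2 real matrices induced by the Euclidean norm on `ℝ²`. -/
noncomputable def opNorm (M : Matrix (Fin 2) (Fin 2) ℝ) : ℝ :=
  ‖Matrix.toEuclideanCLM (𝕜 := ℝ) M‖

/-- For a word `I = (i₀, …, i_{n-1}) ∈ {1,2}ⁿ` (symbol `1` encoded as `0 : Fin 2`,
symbol `2` as `1 : Fin 2`), the matrix `𝒜_I = A_{i_{n-1}} ⋯ A_{i₁} A_{i₀}`. -/
def wordProd (n : ℕ) (I : Fin n → Fin 2) : Matrix (Fin 2) (Fin 2) ℝ :=
  ((List.ofFn fun l : Fin n => if I l = 0 then A1 else A2).reverse).prod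

/-- `s_n(t) = ∑_{I ∈ {1,2}ⁿ} ‖𝒜_I‖^t`. -/
noncomputable def sFun (n : ℕ) (t : ℝ) : ℝ :=
  ∑ I : Fin n → Fin 2, opNorm (wordProd n I) ^ t

theorem opNorm_mul_le (M N : Matrix (Fin 2) (Fin 2) ℝ) :
    opNorm (M * N) ≤ opNorm M * opNorm N := by
  unfold opNorm
  rw [map_mul]
  exact norm_mul_le _ _

theorem opNorm_pos (M : Matrix (Fin 2) (Fin 2) ℝ) (h : M.det = 1) : 0 < opNorm M := by
  unfold opNorm
  rw [norm_pos_iff]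
  intro h0
  have : M = 0 := by
    have := congrArg (Matrix.toEuclideanCLM (𝕜 := ℝ) (n := Fin 2)).symm h0
    simpa using this
  rw [this] at h
  simp at h

theorem opNorm_bound (M : Matrix (Fin 2) (Fin 2) ℝ) (σ : ℝ) (hσ : 0 ≤ σ)
    (h : ∀ x y : ℝ, (M 0 0 * x + M 0 1 * y)^2 + (M 1 0 * x + M 1 1 * y)^2 ≤ σ^2 * (x^2+y^2)) :
    opNorm M ≤ σ := by
  unfold opNorm
  refine ContinuousLinearMap.opNorm_le_bound _ hσ fun v => ?_
  apply le_of_sq_le_sq _ (by positivity)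
  rw [mul_pow, EuclideanSpace.norm_sq_eq, EuclideanSpace.norm_sq_eq]
  simp only [Fin.sum_univ_two, Real.norm_eq_abs, sq_abs]
  have := h (v 0) (v 1)
  simpa [Matrix.ofLp_toEuclideanCLM, Matrix.mulVec, dotProduct, Fin.sum_univ_two] using this

theorem one_le_opNorm (M : Matrix (Fin 2) (Fin 2) ℝ) (h : 1 ≤ M 0 0) : 1 ≤ opNorm M := by
  unfold opNorm
  have h1 := (Matrix.toEuclideanCLM (𝕜 := ℝ) M).le_opNorm (EuclideanSpace.single 0 1)
  have h2 := PiLp.norm_apply_le (Matrix.toEuclideanCLM (𝕜 := ℝ) M (EuclideanSpace.single 0 1)) 0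
  have h3 : (Matrix.toEuclideanCLM (𝕜 := ℝ) M (EuclideanSpace.single 0 1)) 0 = M 0 0 := by
    simp [Matrix.ofLp_toEuclideanCLM]
  rw [h3, Real.norm_eq_abs, abs_of_nonneg (by linarith)] at h2
  simp at h1
  linarith

theorem A1_pow (k : ℕ) : A1 ^ k = !![1, 0; (k:ℝ), 1] := by
  induction k with
  | zero => simp [Matrix.one_fin_two]
  | succ k ih => rw [pow_succ, ih, A1]; simp

theorem A2_pow (k : ℕ) : A2 ^ k = !![1, (k:ℝ); 0, 1] := by
  induction k with
  | zero => simp [Matrix.one_fin_two]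
  | succ k ih => rw [pow_succ, ih, A2]; simp [add_comm]

theorem ineq_aux (k x y : ℝ) (hk : 0 < k) :
    x^2 + (k*x+y)^2 ≤ (k + 1/k)^2 * (x^2+y^2) := by
  have : (k + 1/k)^2 * (x^2+y^2) - (x^2 + (k*x+y)^2)
      = (x - k*y)^2 + (x/k)^2 + y^2 + (y/k)^2 := by
    field_simp; ring
  nlinarith [sq_nonneg (x - k*y), sq_nonneg (x/k), sq_nonneg y, sq_nonneg (y/k)]

theorem A1_norm (k : ℕ) (hk : 0 < k) : opNorm (A1 ^ k) ≤ (k:ℝ) + 1/(k:ℝ) := by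
  refine opNorm_bound _ _ (by positivity) fun x y => ?_
  rw [A1_pow]
  have := ineq_aux k x y (by exact_mod_cast hk)
  simpa using this

theorem A2_norm (k : ℕ) (hk : 0 < k) : opNorm (A2 ^ k) ≤ (k:ℝ) + 1/(k:ℝ) := by
  refine opNorm_bound _ _ (by positivity) fun x y => ?_
  rw [A2_pow]
  have := ineq_aux k y x (by exact_mod_cast hk)
  simp only [Matrix.of_apply, Matrix.cons_val', Matrix.cons_val_zero, Matrix.cons_val_one,
    Matrix.cons_val_fin_one]
  linarith

noncomputable def FF (t : ℝ) : ℕ → Matrix (Fin 2) (Fin 2) ℝ → ℝ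
  | 0, M => opNorm M ^ t
  | n+1, M => FF t n (A1 * M) + FF t n (A2 * M)

theorem FF_nonneg (t : ℝ) (n : ℕ) : ∀ M, 0 ≤ FF t n M := by
  induction n with
  | zero => intro M; exact Real.rpow_nonneg (norm_nonneg _) _
  | succ n ih => intro M; exact add_nonneg (ih _) (ih _)

theorem wordProd_cons (n : ℕ) (i : Fin 2) (J : Fin n → Fin 2) :
    wordProd (n+1) (Fin.cons i J) = wordProd n J * (if i = 0 then A1 else A2) := by
  simp [wordProd, List.ofFn_succ]

theorem FF_eq (t : ℝ) (n : ℕ) : ∀ M,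
    ∑ I : Fin n → Fin 2, opNorm (wordProd n I * M) ^ t = FF t n M := by
  induction n with
  | zero => intro M; simp [FF, wordProd]
  | succ n ih =>
    intro M
    rw [← (Fin.consEquiv (fun _ : Fin (n+1) => Fin 2)).sum_comp, Fintype.sum_prod_type,
      Fin.sum_univ_two]
    simp only [Fin.consEquiv, Equiv.coe_fn_mk, wordProd_cons, FF, ← ih, mul_assoc]
    simp

theorem sFun_eq (t : ℝ) (n : ℕ) : sFun n t = FF t n 1 := by
  simp [sFun, ← FF_eq]

theorem FF_expand (t : ℝ) (A B M : Matrix (Fin 2) (Fin 2) ℝ)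
    (hF : ∀ n M, FF t (n+1) M = FF t n (A*M) + FF t n (B*M)) (n N : ℕ) (hN : N ≤ n) :
    FF t n (A * M) = ∑ k ∈ Finset.range N, FF t (n-(k+1)) (B * (A^(k+1) * M))
      + FF t (n-N) (A^(N+1) * M) := by
  induction N with
  | zero => simp
  | succ N ih =>
    rw [ih (by omega), Finset.sum_range_succ]
    obtain ⟨m, hm⟩ : ∃ m, n - N = m + 1 := ⟨n - N - 1, by omega⟩
    have hm' : n - (N+1) = m := by omega
    rw [hm, hm', hF, ← mul_assoc A, ← pow_succ']
    ring

theorem rpow_bound (t : ℝ) (ht : t ≤ 0) (A M : Matrix (Fin 2) (Fin 2) ℝ) (hA : A.det = 1)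
    (hM : M.det = 1) (k : ℕ) (hk : 0 < k) (hn : opNorm (A^k) ≤ (k:ℝ) + 1/(k:ℝ)) :
    ((k:ℝ) + 1/(k:ℝ)) ^ t * opNorm M ^ t ≤ opNorm (A^k * M) ^ t := by
  rw [← Real.mul_rpow (by positivity) (opNorm_pos M hM).le]
  refine Real.rpow_le_rpow_of_nonpos (opNorm_pos _ (by simp [hA, hM])) ?_ ht
  exact (opNorm_mul_le _ _).trans (mul_le_mul_of_nonneg_right hn (opNorm_pos M hM).le)

theorem step (t : ℝ) (ht : t ≤ 0) (A B : Matrix (Fin 2) (Fin 2) ℝ) (hA : A.det = 1)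
    (hF : ∀ n M, FF t (n+1) M = FF t n (A*M) + FF t n (B*M))
    (hn : ∀ k : ℕ, 0 < k → opNorm (A^k) ≤ (k:ℝ) + 1/(k:ℝ))
    (N : ℕ) (c ρ : ℝ) (hc : 0 < c) (hρ : 0 < ρ)
    (hc1 : ∀ k : ℕ, k < N → c * ρ^(k+1) ≤ (((k+1:ℕ):ℝ) + 1/((k+1:ℕ):ℝ)) ^ t)
    (hs : 1 ≤ ∑ k ∈ Finset.range N, (((k+1:ℕ):ℝ) + 1/((k+1:ℕ):ℝ)) ^ t * (ρ⁻¹)^(k+1))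
    (n : ℕ)
    (ih : ∀ m < n, ∀ M : Matrix (Fin 2) (Fin 2) ℝ, M.det = 1 →
      c * ρ^(m+1) * opNorm M ^ t ≤ FF t m (B * M))
    (M : Matrix (Fin 2) (Fin 2) ℝ) (hM : M.det = 1) :
    c * ρ^(n+1) * opNorm M ^ t ≤ FF t n (A * M) := by
  have hMt : 0 ≤ opNorm M ^ t := Real.rpow_nonneg (opNorm_pos M hM).le _
  rcases lt_or_ge n N with h | h
  · rw [FF_expand t A B M hF n n le_rfl]
    have h1 : 0 ≤ ∑ k ∈ Finset.range n, FF t (n-(k+1)) (B * (A^(k+1) * M)) :=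
      Finset.sum_nonneg fun k _ => FF_nonneg _ _ _
    have h2 : FF t (n-n) (A^(n+1)*M) = opNorm (A^(n+1)*M) ^ t := by simp [FF]
    have h3 := rpow_bound t ht A M hA hM (n+1) (by omega) (hn _ (by omega))
    have h4 := mul_le_mul_of_nonneg_right (hc1 n h) hMt
    linarith
  · rw [FF_expand t A B M hF n N h]
    have h1 := FF_nonneg t (n-N) (A^(N+1)*M)
    have h2 : ∀ k ∈ Finset.range N,
        (c * ρ^(n+1) * opNorm M ^ t) * ((((k+1:ℕ):ℝ) + 1/((k+1:ℕ):ℝ)) ^ t * (ρ⁻¹)^(k+1))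
          ≤ FF t (n-(k+1)) (B * (A^(k+1) * M)) := by
      intro k hk
      have hk := Finset.mem_range.1 hk
      have h3 := rpow_bound t ht A M hA hM (k+1) (by omega) (hn _ (by omega))
      refine le_trans ?_ (ih (n-(k+1)) (by omega) (A^(k+1)*M) (by simp [hA, hM]))
      have h5 : ρ^(n+1) * (ρ⁻¹)^(k+1) = ρ^(n-(k+1)+1) := by
        have : n + 1 = (n-(k+1)+1) + (k+1) := by omega
        rw [this, pow_add _ (n-(k+1)+1), mul_assoc, ← mul_pow, mul_inv_cancel₀ hρ.ne']
        simp
      calc _ = c * (ρ^(n+1) * (ρ⁻¹)^(k+1)) *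
            ((((k+1:ℕ):ℝ) + 1/((k+1:ℕ):ℝ)) ^ t * opNorm M ^ t) := by ring
        _ ≤ _ := by
          rw [h5]
          exact mul_le_mul_of_nonneg_left h3 (by positivity)
    have h6 := Finset.sum_le_sum h2
    rw [← Finset.mul_sum] at h6
    have h7 : 0 ≤ c * ρ^(n+1) * opNorm M ^ t := by positivity
    nlinarith [mul_le_mul_of_nonneg_left hs h7]

theorem main_bound (t : ℝ) (ht : t ≤ 0) (N : ℕ) (c ρ : ℝ) (hc : 0 < c) (hρ : 0 < ρ)
    (hc1 : ∀ k : ℕ, k < N → c * ρ^(k+1) ≤ (((k+1:ℕ):ℝ) + 1/((k+1:ℕ):ℝ)) ^ t)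
    (hs : 1 ≤ ∑ k ∈ Finset.range N, (((k+1:ℕ):ℝ) + 1/((k+1:ℕ):ℝ)) ^ t * (ρ⁻¹)^(k+1))
    (n : ℕ) : ∀ M : Matrix (Fin 2) (Fin 2) ℝ, M.det = 1 →
      c * ρ^(n+1) * opNorm M ^ t ≤ FF t n (A1 * M) ∧
      c * ρ^(n+1) * opNorm M ^ t ≤ FF t n (A2 * M) := by
  induction n using Nat.strong_induction_on with
  | _ n ih =>
    intro M hM
    exact ⟨step t ht A1 A2 (by simp [A1]) (fun _ _ => rfl) A1_norm N c ρ hc hρ hc1 hs n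
        (fun m hm M hM => (ih m hm M hM).2) M hM,
      step t ht A2 A1 (by simp [A2]) (fun _ _ => add_comm _ _) A2_norm N c ρ hc hρ hc1 hs n
        (fun m hm M hM => (ih m hm M hM).1) M hM⟩

theorem FF_two_pow (t : ℝ) (ht : 0 ≤ t) (n : ℕ) : ∀ M : Matrix (Fin 2) (Fin 2) ℝ,
    1 ≤ M 0 0 → 0 ≤ M 1 0 → 2^n ≤ FF t n M := by
  induction n with
  | zero =>
    intro M h _
    simpa [FF] using Real.one_le_rpow (one_le_opNorm M h) ht
  | succ n ih =>
    intro M h h'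
    have h1 := ih (A1 * M) (by simp [A1, Matrix.mul_apply, Fin.sum_univ_two, h])
      (by simp [A1, Matrix.mul_apply, Fin.sum_univ_two]; linarith)
    have h2 := ih (A2 * M) (by simp [A2, Matrix.mul_apply, Fin.sum_univ_two]; linarith)
      (by simp [A2, Matrix.mul_apply, Fin.sum_univ_two]; linarith)
    rw [FF, pow_succ]
    linarith

theorem limit_pos (s : ℕ → ℝ) (p c ρ : ℝ) (hc : 0 < c) (hρ : 1 < ρ)
    (hs : ∀ n, c * ρ^(n+1) ≤ s (n+1))
    (h : Tendsto (fun n : ℕ => Real.log (s n) / n) atTop (nhds p)) : 0 < p := by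
  have h1 : Tendsto (fun n : ℕ => Real.log c / n + Real.log ρ) atTop (nhds (0 + Real.log ρ)) :=
    (tendsto_const_div_atTop_nhds_zero_nat _).add_const _
  have h2 : 0 + Real.log ρ ≤ p := by
    refine le_of_tendsto_of_tendsto h1 h ?_
    filter_upwards [eventually_ge_atTop 1] with n hn
    obtain ⟨m, rfl⟩ : ∃ m, n = m + 1 := ⟨n-1, by omega⟩
    have h3 : Real.log c + ((m+1:ℕ):ℝ) * Real.log ρ ≤ Real.log (s (m+1)) := by
      rw [← Real.log_pow, ← Real.log_mul hc.ne' (by positivity)]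
      exact Real.log_le_log (by positivity) (hs m)
    have h4 : (0:ℝ) < ((m+1:ℕ):ℝ) := by positivity
    rw [le_div_iff₀ h4, add_mul, div_mul_cancel₀ _ h4.ne']
    linarith
  have := Real.log_pos hρ
  linarith

theorem exists_N (t' t : ℝ) (h : t' < t)
    (ht' : HasSum (fun n : ℕ => (((n+1:ℕ):ℝ) + 1/((n+1:ℕ):ℝ)) ^ t') 1) :
    ∃ N : ℕ, 1 < ∑ k ∈ Finset.range N, (((k+1:ℕ):ℝ) + 1/((k+1:ℕ):ℝ)) ^ t := by
  have h2 : (2:ℝ)^t' < 2^t := Real.rpow_lt_rpow_of_exponent_lt (by norm_num) h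
  have h3 := ht'.tendsto_sum_nat.eventually_const_lt
    (show 1 - ((2:ℝ)^t - 2^t') < 1 by linarith)
  obtain ⟨N, hN, hN0⟩ := (h3.and (eventually_ge_atTop 1)).exists
  refine ⟨N, ?_⟩
  obtain ⟨m, rfl⟩ : ∃ m, N = m + 1 := ⟨N-1, by omega⟩
  rw [Finset.sum_range_succ'] at hN ⊢
  have h5 : ∑ k ∈ Finset.range m, (((k+1+1:ℕ):ℝ) + 1/((k+1+1:ℕ):ℝ)) ^ t' ≤
      ∑ k ∈ Finset.range m, (((k+1+1:ℕ):ℝ) + 1/((k+1+1:ℕ):ℝ)) ^ t := by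
    refine Finset.sum_le_sum fun k _ => Real.rpow_le_rpow_of_exponent_le ?_ h.le
    have : (0:ℝ) ≤ 1/((k+1+1:ℕ):ℝ) := by positivity
    have : (1:ℝ) ≤ ((k+1+1:ℕ):ℝ) := by exact_mod_cast (by omega)
    linarith
  have h6 : (((0+1:ℕ):ℝ) + 1/((0+1:ℕ):ℝ)) = 2 := by norm_num
  rw [h6] at hN ⊢
  linarith

theorem exists_rho (N : ℕ) (a : ℕ → ℝ) (h : 1 < ∑ k ∈ Finset.range N, a k) :
    ∃ ρ : ℝ, 1 < ρ ∧ 1 ≤ ∑ k ∈ Finset.range N, a k * (ρ⁻¹)^(k+1) := by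
  have hc : ContinuousAt (fun ρ : ℝ => ∑ k ∈ Finset.range N, a k * (ρ⁻¹)^(k+1)) 1 := by
    refine tendsto_finsetSum _ fun k _ => ?_
    exact continuousAt_const.mul ((continuousAt_inv₀ one_ne_zero).pow _)
  have h1 := hc.eventually_const_lt (u := 1) (by simpa using h)
  have h2 : ∀ᶠ ρ in nhdsWithin (1:ℝ) (Set.Ioi 1), 1 < ρ ∧
      1 < ∑ k ∈ Finset.range N, a k * (ρ⁻¹)^(k+1) :=
    (eventually_mem_nhdsWithin).and (h1.filter_mono nhdsWithin_le_nhds)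
  obtain ⟨ρ, h3, h4⟩ := h2.exists
  exact ⟨ρ, h3, h4.le⟩

/-- Let `t'` be the unique real number with
`∑_{n=1}^∞ (n + 1/n)^{t'} = 1`.  Then `P(t) > 0` for every `t > t'`, where
`P(t) = lim_{n→∞} (1/n) log s_n(t)`. -/
theorem stmt16 (t' : ℝ)
    (ht' : Summable (fun n : ℕ+ => ((n : ℝ) + 1 / (n : ℝ)) ^ t'))
    (ht'1 : ∑' n : ℕ+, ((n : ℝ) + 1 / (n : ℝ)) ^ t' = 1)
    (P : ℝ → ℝ)
    (hP : ∀ t : ℝ, Tendsto (fun n : ℕ => Real.log (sFun n t) / n) atTop (nhds (P t))) :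
    ∀ t : ℝ, t' < t → 0 < P t := by
  intro t ht
  rcases le_or_gt 0 t with h0 | h0
  · refine limit_pos (fun n => sFun n t) (P t) 1 2 one_pos one_lt_two (fun n => ?_) (hP t)
    rw [one_mul]
    simp only [sFun_eq]
    exact FF_two_pow t h0 (n+1) 1 (by simp) (by simp)
  · have hs : HasSum (fun n : ℕ => (((n+1:ℕ):ℝ) + 1/((n+1:ℕ):ℝ)) ^ t') 1 := by
      have := ht'.hasSum
      rw [ht'1] at this
      exact (Equiv.pnatEquivNat.symm.hasSum_iff
        (f := fun n : ℕ+ => ((n : ℝ) + 1 / (n : ℝ)) ^ t')).2 this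
    obtain ⟨N, hN⟩ := exists_N t' t ht hs
    obtain ⟨ρ, hρ, hsum⟩ := exists_rho N _ hN
    have hρ0 : 0 < ρ := by linarith
    set c : ℝ := ((N:ℝ)+1)^t * (ρ^N)⁻¹ with hcdef
    have hc : 0 < c := by positivity
    have hc1 : ∀ k : ℕ, k < N → c * ρ^(k+1) ≤ (((k+1:ℕ):ℝ) + 1/((k+1:ℕ):ℝ)) ^ t := by
      intro k hk
      have e1 : (ρ^N)⁻¹ * ρ^(k+1) ≤ 1 := by
        rw [inv_mul_le_iff₀ (by positivity), mul_one]
        exact pow_le_pow_right₀ hρ.le hk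
      have e2 : ((N:ℝ)+1)^t ≤ (((k+1:ℕ):ℝ) + 1/((k+1:ℕ):ℝ)) ^ t := by
        refine Real.rpow_le_rpow_of_nonpos (by positivity) ?_ h0.le
        have e3 : ((k+1:ℕ):ℝ) ≤ N := by exact_mod_cast hk
        have e4 : 1/((k+1:ℕ):ℝ) ≤ 1 := by
          rw [div_le_one (by positivity)]
          exact_mod_cast (by omega)
        linarith
      have e5 : 0 < ((N:ℝ)+1)^t := by positivity
      rw [hcdef, mul_assoc]
      nlinarith
    refine limit_pos (fun n => sFun n t) (P t) (c * opNorm 1 ^ t) ρ ?_ hρ (fun n => ?_) (hP t)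
    · have := Real.rpow_pos_of_pos (opNorm_pos 1 (by simp)) t
      positivity
    · have h1 := (main_bound t h0.le N c ρ hc hρ0 hc1 hsum n 1 (by simp)).1
      have h2 := FF_nonneg t n (A2 * 1)
      simp only [sFun_eq, FF]
      linarith
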